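/- For every integer k ≥ 1, the function f̃_k is convex on the interval [0,1]. -/

import Mathlib

/-- The tent (sawtooth) map `T₁`. -/
noncomputable def T1 (x : ℝ) : ℝ := if x ≤ 1/2 then 2*x else 2*(1-x)

/-- `f̃_k(x) = x − Σ_{i=1}^k T_i(x)/4^i`, where `T_i = T₁^[i]`. -/
noncomputable def ftilde (k : ℕ) (x : ℝ) : ℝ :=
  x - ∑ i ∈ Finset.range k, T1^[i+1] x / 4^(i+1)

theorem T1_mem_Icc {x : ℝ} (hx : x ∈ Set.Icc (0:ℝ) 1) : T1 x ∈ Set.Icc (0:ℝ) 1 := by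
  obtain ⟨h0, h1⟩ := hx
  unfold T1
  split_ifs with h
  · constructor <;> linarith
  · constructor <;> linarith

theorem ftilde_succ (k : ℕ) (x : ℝ) :
    ftilde (k + 1) x = x - T1 x / 2 + ftilde k (T1 x) / 4 := by
  have h : ∑ i ∈ Finset.range k, T1^[i + 1 + 1] x / 4 ^ (i + 1 + 1)
      = (∑ i ∈ Finset.range k, T1^[i + 1] (T1 x) / 4 ^ (i + 1)) / 4 := by
    rw [Finset.sum_div]
    refine Finset.sum_congr rfl fun i _ => ?_
    rw [Function.iterate_succ_apply T1 (i + 1) x, pow_succ 4 (i + 1), div_mul_eq_div_div]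
  unfold ftilde
  rw [Finset.sum_range_succ', h]
  simp only [zero_add, Function.iterate_one, pow_one]
  ring

/-- The defect `f̃_k(x) − x² − 4^{-(k+1)}` is transported by the tent map. -/
theorem ftilde_succ_sub_sq (k : ℕ) (x : ℝ) :
    ftilde (k + 1) x - x ^ 2 - 1 / 4 ^ (k + 2)
      = (ftilde k (T1 x) - T1 x ^ 2 - 1 / 4 ^ (k + 1)) / 4 := by
  rw [ftilde_succ, pow_succ 4 (k + 1), ← div_div]
  unfold T1
  split_ifs <;> ring

theorem ftilde_sub_sq_ge (k : ℕ) (j : ℤ) {x : ℝ} (hx : x ∈ Set.Icc (0:ℝ) 1) :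
    -(x - (2 * j + 1) / 2 ^ (k + 1)) ^ 2 ≤ ftilde k x - x ^ 2 - 1 / 4 ^ (k + 1) := by
  induction k generalizing j x with
  | zero =>
    obtain ⟨h0, h1⟩ := hx
    simp only [ftilde, Finset.range_zero, Finset.sum_empty, zero_add, pow_one]
    rcases lt_trichotomy j 0 with h | rfl | h
    · have h' : (j : ℝ) ≤ -1 := by exact_mod_cast (by omega : j ≤ -1)
      nlinarith
    · push_cast
      nlinarith
    · have h' : (1 : ℝ) ≤ j := by exact_mod_cast h
      nlinarith
  | succ k ih =>
    rw [ftilde_succ_sub_sq]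
    have hp : (2 : ℝ) ^ (k + 1) ≠ 0 := by positivity
    by_cases h : x ≤ 1 / 2
    · have := ih j (T1_mem_Icc hx)
      refine le_trans (le_of_eq ?_) (div_le_div_of_nonneg_right this (by norm_num))
      rw [T1, if_pos h, pow_succ 2 (k + 1)]
      field_simp
      ring
    · have := ih (2 ^ (k + 1) - j - 1) (T1_mem_Icc hx)
      refine le_trans (le_of_eq ?_) (div_le_div_of_nonneg_right this (by norm_num))
      rw [T1, if_neg h, pow_succ 2 (k + 1)]
      push_cast
      field_simp
      ring

theorem exists_ftilde_sub_sq_eq (k : ℕ) (x : ℝ) :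
    ∃ j : ℤ, ftilde k x - x ^ 2 - 1 / 4 ^ (k + 1) = -(x - (2 * j + 1) / 2 ^ (k + 1)) ^ 2 := by
  induction k generalizing x with
  | zero =>
    refine ⟨0, ?_⟩
    simp only [ftilde, Finset.range_zero, Finset.sum_empty, zero_add, pow_one]
    push_cast
    ring
  | succ k ih =>
    obtain ⟨j, hj⟩ := ih (T1 x)
    have hp : (2 : ℝ) ^ (k + 1) ≠ 0 := by positivity
    rw [ftilde_succ_sub_sq, hj]
    by_cases h : x ≤ 1 / 2
    · refine ⟨j, ?_⟩
      rw [T1, if_pos h, pow_succ 2 (k + 1)]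
      field_simp
      ring
    · refine ⟨2 ^ (k + 1) - j - 1, ?_⟩
      rw [T1, if_neg h, pow_succ 2 (k + 1)]
      push_cast
      field_simp
      ring

/-- For every `k ≥ 1`, the function `f̃_k` is convex on `[0,1]`. -/
theorem stmt11 (k : ℕ) (hk : 1 ≤ k) :
    ConvexOn ℝ (Set.Icc (0:ℝ) 1) (ftilde k) := by
  refine ⟨convex_Icc 0 1, fun x hx y hy s t hs ht hst => ?_⟩
  simp only [smul_eq_mul]
  obtain ⟨j, hj⟩ := exists_ftilde_sub_sq_eq k (s * x + t * y)
  have h1 := mul_le_mul_of_nonneg_left (ftilde_sub_sq_ge k j hx) hs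
  have h2 := mul_le_mul_of_nonneg_left (ftilde_sub_sq_ge k j hy) ht
  obtain rfl : t = 1 - s := by linarith
  generalize ((2 * j + 1) / 2 ^ (k + 1) : ℝ) = a at *
  linarith
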